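/- arXiv:2204.04864 — 4 statements merged into one kernel-verified Lean document; each statement's English description precedes it below -/
import Mathlib

section
/- Suppose G(Λ, T₁, T₂, W_j) is a DVNUG frame for ℓ²(Λ, ℂ^S) with frame bounds A₀ and B₀. For each j ∈ T₂ let μ_{W_j} ∈ ℓ²(Λ, ℂ) be the arithmetic mean sequence μ_{W_j}(λ) = (1/S) Σ_{k=1}^{S} [W_j(λ)]_k. Then {E_{m/M} R_{2Nλ} μ_{W_j} : λ ∈ Λ, m ∈ T₁, j ∈ T₂} is a discrete nonuniform Gabor frame for ℓ²(Λ, ℂ) with frame bounds A₀/S and B₀/S; that is, (A₀/S)‖x‖² ≤ Σ_{λ∈Λ} Σ_{m∈T₁} Σ_{j∈T₂} |⟨x, E_{m/M} R_{2Nλ} μ_{W_j}⟩|² ≤ (B₀/S)‖x‖² for all x ∈ ℓ²(Λ, ℂ). -/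
noncomputable section

open MeasureTheory Complex

namespace DVNUG

/-- The nonuniform translation set `Λ = {0, r/N} + 2ℤ`. -/
def Lambda (N r : ℕ) : Set ℝ :=
  {x : ℝ | ∃ n : ℤ, x = 2 * n ∨ x = (r : ℝ) / N + 2 * n}

/-- The spectrum `Ω = [0, 1/2) ∪ [N/2, (N+1)/2)`. -/
def Omega (N : ℕ) : Set ℝ :=
  Set.Ico (0 : ℝ) (1 / 2) ∪ Set.Ico ((N : ℝ) / 2) (((N : ℝ) + 1) / 2)

/-- Inner product on `ℂ^n` (paper convention `⟨x, y⟩ = Σ xₖ conj(yₖ)`). -/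
def csInner {n : ℕ} (x y : Fin n → ℂ) : ℂ :=
  ∑ k, x k * (starRingEnd ℂ) (y k)

/-- Squared Euclidean norm on `ℂ^n`. -/
def csNormSq {n : ℕ} (x : Fin n → ℂ) : ℝ := ∑ k, ‖x k‖ ^ 2

/-- Euclidean norm on `ℂ^n`. -/
def csNorm {n : ℕ} (x : Fin n → ℂ) : ℝ := Real.sqrt (csNormSq x)

/-- Membership in `ℓ²(Λ, ℂ^S)`. -/
def MemL2 (Λ : Set ℝ) {S : ℕ} (Z : ℝ → Fin S → ℂ) : Prop :=
  Summable fun lam : Λ => csNormSq (Z (lam : ℝ))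

/-- Inner product of `ℓ²(Λ, ℂ^S)`: `⟨Z, W⟩ = Σ_{λ∈Λ} Σ_k [Z(λ)]ₖ conj([W(λ)]ₖ)`. -/
def l2inner (Λ : Set ℝ) {S : ℕ} (Z W : ℝ → Fin S → ℂ) : ℂ :=
  ∑' lam : Λ, csInner (Z (lam : ℝ)) (W (lam : ℝ))

/-- Squared norm of `ℓ²(Λ, ℂ^S)`. -/
def l2normSq (Λ : Set ℝ) {S : ℕ} (Z : ℝ → Fin S → ℂ) : ℝ :=
  ∑' lam : Λ, csNormSq (Z (lam : ℝ))

/-- Shift operator `(R_a Z)(x) = Z(x − a)`. -/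
def shiftOp {S : ℕ} (a : ℝ) (Z : ℝ → Fin S → ℂ) : ℝ → Fin S → ℂ :=
  fun x => Z (x - a)

/-- Modulation operator `(E_b Z)(x) = e^{2πibx} Z(x)`. -/
def modOp {S : ℕ} (b : ℝ) (Z : ℝ → Fin S → ℂ) : ℝ → Fin S → ℂ :=
  fun x k => Complex.exp (2 * Real.pi * Complex.I * b * x) * Z x k

/-- Fourier transform: `[F(Z)(ξ)]ₖ = Σ_{λ∈Λ} [Z(λ)]ₖ e^{2πiλξ}`. -/
def fourier (N r : ℕ) {S : ℕ} (Z : ℝ → Fin S → ℂ) : ℝ → Fin S → ℂ :=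
  fun ξ k => ∑' lam : Lambda N r,
    Z (lam : ℝ) k * Complex.exp (2 * Real.pi * Complex.I * (lam : ℝ) * ξ)

/-- Gabor coefficient `⟨Z, E_{m/M} R_{2Nλ} W⟩`. -/
def gaborCoeff (N r M : ℕ) {S : ℕ} (Z W : ℝ → Fin S → ℂ) (m : ℕ) (lam : ℝ) : ℂ :=
  l2inner (Lambda N r) Z (modOp ((m : ℝ) / M) (shiftOp (2 * N * lam) W))

/-- For a fixed `λ ∈ Λ`, the sum `Σ_{m∈T₁} Σ_{j∈T₂} |⟨Z, E_{m/M} R_{2Nλ} W_j⟩|²`. -/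
def gaborSumFn (N r M P : ℕ) {S : ℕ} (W : ℕ → ℝ → Fin S → ℂ) (Z : ℝ → Fin S → ℂ)
    (lam : Lambda N r) : ℝ :=
  ∑ m ∈ Finset.range M, ∑ j ∈ Finset.range (P + 1),
    ‖gaborCoeff N r M Z (W j) m (lam : ℝ)‖ ^ 2

/-- The DVNUG system `G(Λ, T₁, T₂, W_j)` is a Bessel sequence with bound `β`. -/
def IsBessel (N r M P : ℕ) {S : ℕ} (W : ℕ → ℝ → Fin S → ℂ) (β : ℝ) : Prop :=
  ∀ Z : ℝ → Fin S → ℂ, MemL2 (Lambda N r) Z →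
    Summable (gaborSumFn N r M P W Z) ∧
    (∑' lam : Lambda N r, gaborSumFn N r M P W Z lam) ≤ β * l2normSq (Lambda N r) Z

/-- The DVNUG system `G(Λ, T₁, T₂, W_j)` is a frame with bounds `α`, `β`. -/
def IsFrame (N r M P : ℕ) {S : ℕ} (W : ℕ → ℝ → Fin S → ℂ) (α β : ℝ) : Prop :=
  ∀ Z : ℝ → Fin S → ℂ, MemL2 (Lambda N r) Z →
    Summable (gaborSumFn N r M P W Z) ∧
    α * l2normSq (Lambda N r) Z ≤ (∑' lam : Lambda N r, gaborSumFn N r M P W Z lam) ∧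
    (∑' lam : Lambda N r, gaborSumFn N r M P W Z lam) ≤ β * l2normSq (Lambda N r) Z

end DVNUG

open DVNUG MeasureTheory Complex


namespace DVNUG

/-- The arithmetic mean sequence `μ_Z(λ) = (1/S) Σ_k [Z(λ)]ₖ`, as an element of `ℓ²(Λ, ℂ)`. -/
def meanSeq {S : ℕ} (Z : ℝ → Fin S → ℂ) : ℝ → Fin 1 → ℂ :=
  fun lam _ => (1 / (S : ℂ)) * ∑ k, Z lam k

/-- The sequence in `ℓ²(Λ, ℂ^S)` all of whose components equal `x / S`. -/
def diagonalSeq (S : ℕ) (x : ℝ → Fin 1 → ℂ) : ℝ → Fin S → ℂ :=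
  fun lam _ => x lam 0 / S

theorem csNormSq_diagonalSeq (S : ℕ) (x : ℝ → Fin 1 → ℂ) (lam : ℝ) :
    csNormSq (diagonalSeq S x lam) = csNormSq (x lam) / S := by
  rcases eq_or_ne S 0 with rfl | hS
  · simp [csNormSq]
  · have hS' : (S : ℝ) ≠ 0 := Nat.cast_ne_zero.mpr hS
    simp only [csNormSq, diagonalSeq, norm_div, norm_natCast, Finset.sum_const,
      Finset.card_univ, Fintype.card_fin, nsmul_eq_mul, Fin.sum_univ_one]
    field_simp

theorem memL2_diagonalSeq {Λ : Set ℝ} (S : ℕ) {x : ℝ → Fin 1 → ℂ} (hx : MemL2 Λ x) :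
    MemL2 Λ (diagonalSeq S x) := by
  simpa only [MemL2, csNormSq_diagonalSeq] using Summable.div_const hx (S : ℝ)

theorem l2normSq_diagonalSeq (Λ : Set ℝ) (S : ℕ) (x : ℝ → Fin 1 → ℂ) :
    l2normSq Λ (diagonalSeq S x) = l2normSq Λ x / S := by
  simp only [l2normSq, csNormSq_diagonalSeq, tsum_div_const]

theorem gaborCoeff_diagonalSeq (N r M : ℕ) {S : ℕ} (x : ℝ → Fin 1 → ℂ) (V : ℝ → Fin S → ℂ)
    (m : ℕ) (lam : ℝ) :
    gaborCoeff N r M (diagonalSeq S x) V m lam = gaborCoeff N r M x (meanSeq V) m lam := by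
  unfold gaborCoeff l2inner
  congr 1
  funext t
  simp only [csInner, modOp, shiftOp, diagonalSeq, meanSeq, Fin.sum_univ_one, map_mul, map_sum,
    map_div₀, map_one, map_natCast, Finset.mul_sum]
  refine Finset.sum_congr rfl fun k _ => ?_
  ring

theorem gaborSumFn_diagonalSeq (N r M P : ℕ) {S : ℕ} (W : ℕ → ℝ → Fin S → ℂ)
    (x : ℝ → Fin 1 → ℂ) :
    gaborSumFn N r M P W (diagonalSeq S x) = gaborSumFn N r M P (fun j => meanSeq (W j)) x := by
  funext lam
  simp only [gaborSumFn, gaborCoeff_diagonalSeq]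

end DVNUG

theorem statement11 (N M S P r : ℕ) (hN : 0 < N) (hM : 0 < M) (hS : 0 < S)
    (hrodd : Odd r) (hrcop : Nat.Coprime r N) (hr1 : 1 ≤ r) (hr2 : r ≤ 2 * N - 1)
    (W : ℕ → ℝ → Fin S → ℂ) (hW : ∀ j ≤ P, MemL2 (Lambda N r) (W j))
    (A₀ B₀ : ℝ) (hA : 0 < A₀) (hAB : A₀ ≤ B₀)
    (hframe : IsFrame N r M P W A₀ B₀) :
    IsFrame N r M P (fun j => meanSeq (W j)) (A₀ / S) (B₀ / S) := by
  intro x hx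
  have h := hframe (diagonalSeq S x) (memL2_diagonalSeq S hx)
  rwa [gaborSumFn_diagonalSeq, l2normSq_diagonalSeq, ← mul_comm_div, ← mul_comm_div] at h
end
end

section
/- Suppose G(Λ, T₁, T₂, W_j) is a DVNUG frame for ℓ²(Λ, ℂ^S) with frame bounds A₀ and B₀. For j ∈ T₂ and l ∈ {1, …, S} let [W_j]_l ∈ ℓ²(Λ, ℂ) denote the l-th coordinate sequence λ ↦ [W_j(λ)]_l. Then for every fixed l₀ ∈ {1, …, S}, the system {E_{m/M} R_{2Nλ} [W_j]_{l₀} : λ ∈ Λ, m ∈ T₁, j ∈ T₂} is a discrete nonuniform Gabor frame for ℓ²(Λ, ℂ) with frame bounds A₀ and B₀; that is, A₀‖x‖² ≤ Σ_{λ∈Λ} Σ_{m∈T₁} Σ_{j∈T₂} |⟨x, E_{m/M} R_{2Nλ} [W_j]_{l₀}⟩|² ≤ B₀‖x‖² for all x ∈ ℓ²(Λ, ℂ). -/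
noncomputable section

open MeasureTheory Complex

open DVNUG MeasureTheory Complex


namespace DVNUG

/-- The `l`-th coordinate sequence of `Z`, as an element of `ℓ²(Λ, ℂ)`. -/
def coordSeq {S : ℕ} (Z : ℝ → Fin S → ℂ) (l : Fin S) : ℝ → Fin 1 → ℂ :=
  fun lam _ => Z lam l

end DVNUG

namespace DVNUG

/-- The sequence in `ℓ²(Λ, ℂ^S)` whose `l`-th coordinate is `x` and whose other coordinates vanish. -/
def embedCoord {S : ℕ} (l : Fin S) (x : ℝ → Fin 1 → ℂ) : ℝ → Fin S → ℂ :=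
  fun lam => Pi.single l (x lam 0)

lemma csNormSq_embedCoord {S : ℕ} (l : Fin S) (x : ℝ → Fin 1 → ℂ) (t : ℝ) :
    csNormSq (embedCoord l x t) = csNormSq (x t) := by
  simp only [csNormSq, embedCoord, Finset.univ_unique, Fin.default_eq_zero, Finset.sum_singleton]
  rw [Finset.sum_eq_single l (fun k _ hk => by simp [hk]) (by simp), Pi.single_eq_same]

lemma csInner_embedCoord {S : ℕ} (l : Fin S) (x : ℝ → Fin 1 → ℂ) (t : ℝ) (y : Fin S → ℂ) :
    csInner (embedCoord l x t) y = csInner (x t) (fun _ => y l) := by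
  simp only [csInner, embedCoord, Finset.univ_unique, Fin.default_eq_zero, Finset.sum_singleton]
  rw [Finset.sum_eq_single l (fun k _ hk => by simp [hk]) (by simp), Pi.single_eq_same]

lemma l2inner_embedCoord (Λ : Set ℝ) {S : ℕ} (l : Fin S) (x : ℝ → Fin 1 → ℂ)
    (Y : ℝ → Fin S → ℂ) :
    l2inner Λ (embedCoord l x) Y = l2inner Λ x (coordSeq Y l) :=
  tsum_congr fun lam => csInner_embedCoord l x lam (Y lam)

lemma gaborCoeff_embedCoord (N r M : ℕ) {S : ℕ} (l : Fin S) (x : ℝ → Fin 1 → ℂ)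
    (W : ℝ → Fin S → ℂ) (m : ℕ) (lam : ℝ) :
    gaborCoeff N r M (embedCoord l x) W m lam = gaborCoeff N r M x (coordSeq W l) m lam :=
  l2inner_embedCoord _ l x _

lemma gaborSumFn_embedCoord (N r M P : ℕ) {S : ℕ} (l : Fin S) (x : ℝ → Fin 1 → ℂ)
    (W : ℕ → ℝ → Fin S → ℂ) :
    gaborSumFn N r M P W (embedCoord l x) = gaborSumFn N r M P (fun j => coordSeq (W j) l) x := by
  funext lam
  simp only [gaborSumFn, gaborCoeff_embedCoord]

end DVNUG

theorem statement12 (N M S P r : ℕ) (hN : 0 < N) (hM : 0 < M) (hS : 0 < S)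
    (hrodd : Odd r) (hrcop : Nat.Coprime r N) (hr1 : 1 ≤ r) (hr2 : r ≤ 2 * N - 1)
    (W : ℕ → ℝ → Fin S → ℂ) (hW : ∀ j ≤ P, MemL2 (Lambda N r) (W j))
    (A₀ B₀ : ℝ) (hA : 0 < A₀) (hAB : A₀ ≤ B₀)
    (hframe : IsFrame N r M P W A₀ B₀) (l₀ : Fin S) :
    IsFrame N r M P (fun j => coordSeq (W j) l₀) A₀ B₀ := by
  intro x hx
  have h := hframe (embedCoord l₀ x) (by simpa only [MemL2, csNormSq_embedCoord] using hx)
  simpa only [gaborSumFn_embedCoord, l2normSq, csNormSq_embedCoord] using h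
end
end

section
/- Let S = 3. Let w_j ∈ ℓ²(Λ, ℂ), j ∈ T₂, be scalar windows such that {E_{m/M} R_{2Nλ} w_j : λ ∈ Λ, m ∈ T₁, j ∈ T₂} is a discrete nonuniform Gabor frame for ℓ²(Λ, ℂ). Define W_j ∈ ℓ²(Λ, ℂ³) by [W_j(λ)]_k = w_j(λ) for k = 1, 2, 3 and all λ ∈ Λ. Then each coordinate system {E_{m/M} R_{2Nλ} [W_j]_l : λ ∈ Λ, m ∈ T₁, j ∈ T₂} (l = 1, 2, 3) is a discrete nonuniform Gabor frame for ℓ²(Λ, ℂ), yet G(Λ, T₁, T₂, W_j) is NOT a DVNUG frame for ℓ²(Λ, ℂ³): there is no α > 0 with α‖Z‖² ≤ Σ_{λ∈Λ} Σ_{m∈T₁} Σ_{j∈T₂} |⟨Z, E_{m/M} R_{2Nλ} W_j⟩|² for all Z ∈ ℓ²(Λ, ℂ³). In particular, the converse of the statement 'rows of the window matrix of a DVNUG frame generate discrete nonuniform Gabor frames' is false. -/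
noncomputable section

open MeasureTheory Complex

open DVNUG MeasureTheory Complex


namespace DVNUG

theorem zero_mem_Lambda (N r : ℕ) : (0 : ℝ) ∈ Lambda N r :=
  ⟨0, Or.inl (by simp)⟩

/-- The sequence supported at `0` with value `v` there. -/
def deltaSeq {S : ℕ} (v : Fin S → ℂ) : ℝ → Fin S → ℂ :=
  fun x k => if x = 0 then v k else 0

theorem csNormSq_deltaSeq {S : ℕ} (v : Fin S → ℂ) {x : ℝ} (hx : x ≠ 0) :
    csNormSq (deltaSeq v x) = 0 := by
  simp [csNormSq, deltaSeq, hx]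

theorem hasSum_csNormSq_deltaSeq (N r : ℕ) {S : ℕ} (v : Fin S → ℂ) :
    HasSum (fun lam : Lambda N r => csNormSq (deltaSeq v (lam : ℝ))) (csNormSq v) := by
  have h := hasSum_single (f := fun lam : Lambda N r => csNormSq (deltaSeq v (lam : ℝ)))
    ⟨0, zero_mem_Lambda N r⟩ fun lam hlam =>
      csNormSq_deltaSeq v fun h0 => hlam (Subtype.ext h0)
  simpa [csNormSq, deltaSeq] using h

/-- A sequence with vanishing coordinate sums is orthogonal to every Gabor system whose windows
have equal coordinates. -/
theorem gaborCoeff_eq_zero_of_sum_eq_zero (N r M : ℕ) {S : ℕ} {Z : ℝ → Fin S → ℂ}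
    (hZ : ∀ x, ∑ k, Z x k = 0) (u : ℝ → ℂ) (m : ℕ) (lam : ℝ) :
    gaborCoeff N r M Z (fun x _ => u x) m lam = 0 := by
  simp only [gaborCoeff, l2inner, csInner, modOp, shiftOp, ← Finset.sum_mul, hZ, zero_mul,
    tsum_zero]

theorem coordSeq_const_coord {S : ℕ} (u : ℝ → Fin 1 → ℂ) (l : Fin S) :
    coordSeq (fun lam (_ : Fin S) => u lam 0) l = u := by
  funext x k
  rw [Subsingleton.elim k 0]
  rfl

end DVNUG

theorem statement13 (N M P r : ℕ) (hN : 0 < N) (hM : 0 < M)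
    (hrodd : Odd r) (hrcop : Nat.Coprime r N) (hr1 : 1 ≤ r) (hr2 : r ≤ 2 * N - 1)
    (w : ℕ → ℝ → Fin 1 → ℂ) (hw : ∀ j ≤ P, MemL2 (Lambda N r) (w j))
    (hwframe : ∃ α β : ℝ, 0 < α ∧ α ≤ β ∧ IsFrame N r M P w α β) :
    (∀ l : Fin 3, ∃ α β : ℝ, 0 < α ∧ α ≤ β ∧
        IsFrame N r M P
          (fun j => coordSeq (fun lam (_ : Fin 3) => w j lam 0) l) α β) ∧
    ¬ ∃ α : ℝ, 0 < α ∧ ∀ Z : ℝ → Fin 3 → ℂ, MemL2 (Lambda N r) Z →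
        α * l2normSq (Lambda N r) Z ≤
          ∑' lam : Lambda N r,
            gaborSumFn N r M P (fun j => fun lam' (_ : Fin 3) => w j lam' 0) Z lam := by
  refine ⟨fun l => by simpa only [coordSeq_const_coord] using hwframe, ?_⟩
  rintro ⟨α, hα, hlower⟩
  have hnorm := hasSum_csNormSq_deltaSeq N r ![(1 : ℂ), -1, 0]
  have hsum : ∀ x, ∑ k, deltaSeq ![(1 : ℂ), -1, 0] x k = 0 := fun x => by
    by_cases hx : x = 0 <;> simp [deltaSeq, hx, Fin.sum_univ_three]
  have h := hlower _ hnorm.summable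
  simp only [gaborSumFn, gaborCoeff_eq_zero_of_sum_eq_zero N r M hsum, l2normSq,
    hnorm.tsum_eq] at h
  have hv : csNormSq ![(1 : ℂ), -1, 0] = 2 := by
    simp [csNormSq, Fin.sum_univ_three, one_add_one_eq_two]
  simp [hv] at h
  linarith
end
end

section
/- Suppose there exists β₀ > 0 such that for every l ∈ {1, …, S} and every j ∈ T₂, the coordinate system {E_{m/M} R_{2Nλ} [W_j]_l : λ ∈ Λ, m ∈ T₁} is a discrete nonuniform Gabor Bessel sequence in ℓ²(Λ, ℂ) with Bessel bound β₀, i.e., Σ_{λ∈Λ} Σ_{m∈T₁} |⟨x, E_{m/M} R_{2Nλ} [W_j]_l⟩|² ≤ β₀‖x‖² for all x ∈ ℓ²(Λ, ℂ). Then G(Λ, T₁, T₂, W_j) is a DVNUG Bessel sequence in ℓ²(Λ, ℂ^S) with Bessel bound 2^{S−1}(P+1)β₀. -/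
noncomputable section

open MeasureTheory Complex

open DVNUG MeasureTheory Complex


namespace DVNUG

theorem sub_mem_Lambda {N r : ℕ} (hN : 0 < N) {lam x : ℝ} (hlam : lam ∈ Lambda N r)
    (hx : x ∈ Lambda N r) : x - 2 * N * lam ∈ Lambda N r := by
  have hN' : (N : ℝ) ≠ 0 := by positivity
  obtain ⟨q, hq⟩ : ∃ q : ℤ, (N : ℝ) * lam = q := by
    obtain ⟨n, rfl | rfl⟩ := hlam
    · exact ⟨N * (2 * n), by push_cast; ring⟩
    · exact ⟨r + N * (2 * n), by push_cast; field_simp⟩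
  have hq' : 2 * (N : ℝ) * lam = 2 * q := by rw [mul_assoc, hq]
  obtain ⟨n, rfl | rfl⟩ := hx
  · exact ⟨n - q, Or.inl (by rw [hq']; push_cast; ring)⟩
  · exact ⟨n - q, Or.inr (by rw [hq']; push_cast; ring)⟩

theorem MemL2.shiftOp {N r S : ℕ} (hN : 0 < N) {Z : ℝ → Fin S → ℂ} (hZ : MemL2 (Lambda N r) Z)
    {lam : ℝ} (hlam : lam ∈ Lambda N r) : MemL2 (Lambda N r) (shiftOp (2 * N * lam) Z) := by
  let τ : Lambda N r → Lambda N r := fun x => ⟨x - 2 * N * lam, sub_mem_Lambda hN hlam x.2⟩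
  have hτ : Function.Injective τ := fun x y h =>
    Subtype.ext (sub_left_injective (congrArg Subtype.val h))
  unfold MemL2 at hZ ⊢
  exact (hZ.comp_injective hτ).congr fun x => rfl

theorem MemL2.modOp {Λ : Set ℝ} {S : ℕ} {Z : ℝ → Fin S → ℂ} (hZ : MemL2 Λ Z) (b : ℝ) :
    MemL2 Λ (modOp b Z) := by
  refine hZ.congr fun x => ?_
  have h : ‖Complex.exp (2 * Real.pi * Complex.I * b * (x : ℝ))‖ = 1 := by
    rw [← Complex.norm_exp_ofReal_mul_I (2 * Real.pi * b * x)]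
    congr 2
    push_cast
    ring
  simp [csNormSq, DVNUG.modOp, h]

theorem MemL2.summable_norm_sq_apply {Λ : Set ℝ} {S : ℕ} {Z : ℝ → Fin S → ℂ} (hZ : MemL2 Λ Z)
    (l : Fin S) : Summable fun x : Λ => ‖Z x l‖ ^ 2 :=
  Summable.of_nonneg_of_le (fun _ => sq_nonneg _)
    (fun x => Finset.single_le_sum (f := fun k => ‖Z x k‖ ^ 2) (fun _ _ => sq_nonneg _)
      (Finset.mem_univ l)) hZ

theorem MemL2.summable_mul_conj {Λ : Set ℝ} {S : ℕ} {Z V : ℝ → Fin S → ℂ} (hZ : MemL2 Λ Z)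
    (hV : MemL2 Λ V) (l : Fin S) :
    Summable fun x : Λ => Z x l * (starRingEnd ℂ) (V x l) := by
  refine Summable.of_norm_bounded
    ((hZ.summable_norm_sq_apply l).add (hV.summable_norm_sq_apply l)) fun x => ?_
  rw [norm_mul, RCLike.norm_conj]
  nlinarith [sq_nonneg (‖Z x l‖ - ‖V x l‖), sq_nonneg ‖Z x l‖, sq_nonneg ‖V x l‖]

theorem csNormSq_coordSeq {S : ℕ} (Z : ℝ → Fin S → ℂ) (l : Fin S) (x : ℝ) :
    csNormSq (coordSeq Z l x) = ‖Z x l‖ ^ 2 := by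
  simp [csNormSq, coordSeq]

theorem MemL2.coordSeq {Λ : Set ℝ} {S : ℕ} {Z : ℝ → Fin S → ℂ} (hZ : MemL2 Λ Z) (l : Fin S) :
    MemL2 Λ (coordSeq Z l) :=
  (hZ.summable_norm_sq_apply l).congr fun x => (csNormSq_coordSeq Z l x).symm

theorem l2normSq_eq_sum_coordSeq {Λ : Set ℝ} {S : ℕ} {Z : ℝ → Fin S → ℂ} (hZ : MemL2 Λ Z) :
    l2normSq Λ Z = ∑ l, l2normSq Λ (coordSeq Z l) := by
  simp only [l2normSq, csNormSq_coordSeq]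
  exact Summable.tsum_finsetSum fun l _ => hZ.summable_norm_sq_apply l

theorem l2inner_eq_sum_coordSeq {Λ : Set ℝ} {S : ℕ} {Z V : ℝ → Fin S → ℂ} (hZ : MemL2 Λ Z)
    (hV : MemL2 Λ V) : l2inner Λ Z V = ∑ l, l2inner Λ (coordSeq Z l) (coordSeq V l) := by
  simp only [l2inner, csInner, coordSeq, Finset.univ_unique, Finset.sum_singleton]
  exact Summable.tsum_finsetSum fun l _ => hZ.summable_mul_conj hV l

theorem gaborCoeff_eq_sum_coordSeq {N r S : ℕ} (hN : 0 < N) (M : ℕ) {Z V : ℝ → Fin S → ℂ}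
    (hZ : MemL2 (Lambda N r) Z) (hV : MemL2 (Lambda N r) V) (m : ℕ) {lam : ℝ}
    (hlam : lam ∈ Lambda N r) :
    gaborCoeff N r M Z V m lam = ∑ l, gaborCoeff N r M (coordSeq Z l) (coordSeq V l) m lam :=
  l2inner_eq_sum_coordSeq hZ ((hV.shiftOp hN hlam).modOp _)

theorem gaborSumFn_le_sum_coordSeq {N r S : ℕ} (hN : 0 < N) (M P : ℕ) {W : ℕ → ℝ → Fin S → ℂ}
    (hW : ∀ j ≤ P, MemL2 (Lambda N r) (W j)) {Z : ℝ → Fin S → ℂ} (hZ : MemL2 (Lambda N r) Z)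
    (lam : Lambda N r) :
    gaborSumFn N r M P W Z lam ≤ S * ∑ j ∈ Finset.range (P + 1), ∑ l,
      gaborSumFn N r M 0 (fun _ => coordSeq (W j) l) (coordSeq Z l) lam := by
  have key : ∀ m, ∀ j ∈ Finset.range (P + 1), ‖gaborCoeff N r M Z (W j) m lam‖ ^ 2 ≤
      S * ∑ l, ‖gaborCoeff N r M (coordSeq Z l) (coordSeq (W j) l) m lam‖ ^ 2 := by
    intro m j hj
    rw [gaborCoeff_eq_sum_coordSeq hN M hZ (hW j (Finset.mem_range_succ_iff.mp hj)) m lam.2]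
    calc _ ≤ (∑ l, ‖gaborCoeff N r M (coordSeq Z l) (coordSeq (W j) l) m lam‖) ^ 2 := by
          gcongr
          exact norm_sum_le _ _
      _ ≤ _ := by
          simpa using sq_sum_le_card_mul_sum_sq (s := (Finset.univ : Finset (Fin S)))
            (f := fun l => ‖gaborCoeff N r M (coordSeq Z l) (coordSeq (W j) l) m lam‖)
  refine (Finset.sum_le_sum fun m _ => Finset.sum_le_sum (key m)).trans_eq ?_
  simp only [gaborSumFn, zero_add, Finset.range_one, Finset.sum_singleton, ← Finset.mul_sum]
  rw [Finset.sum_comm]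
  exact congrArg _ (Finset.sum_congr rfl fun j _ => Finset.sum_comm)

theorem gaborSumFn_nonneg (N r M P : ℕ) {S : ℕ} (W : ℕ → ℝ → Fin S → ℂ) (Z : ℝ → Fin S → ℂ)
    (lam : Lambda N r) : 0 ≤ gaborSumFn N r M P W Z lam :=
  Finset.sum_nonneg fun _ _ => Finset.sum_nonneg fun _ _ => sq_nonneg _

theorem l2normSq_nonneg (Λ : Set ℝ) {S : ℕ} (Z : ℝ → Fin S → ℂ) : 0 ≤ l2normSq Λ Z :=
  tsum_nonneg fun _ => Finset.sum_nonneg fun _ _ => sq_nonneg _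

end DVNUG

theorem statement15 (N M S P r : ℕ) (hN : 0 < N) (hM : 0 < M) (hS : 0 < S)
    (hrodd : Odd r) (hrcop : Nat.Coprime r N) (hr1 : 1 ≤ r) (hr2 : r ≤ 2 * N - 1)
    (W : ℕ → ℝ → Fin S → ℂ) (hW : ∀ j ≤ P, MemL2 (Lambda N r) (W j))
    (β₀ : ℝ) (hβ₀ : 0 < β₀)
    (hcoord : ∀ l : Fin S, ∀ j ≤ P, IsBessel N r M 0 (fun _ => coordSeq (W j) l) β₀) :
    IsBessel N r M P W (2 ^ (S - 1) * (P + 1) * β₀) := by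
  intro Z hZ
  have hsum : ∀ j ∈ Finset.range (P + 1), ∀ l ∈ Finset.univ, Summable
      (gaborSumFn N r M 0 (fun _ => coordSeq (W j) l) (coordSeq Z l)) := fun j hj l _ =>
    (hcoord l j (Finset.mem_range_succ_iff.mp hj) _ (hZ.coordSeq l)).1
  have hmaj : Summable fun lam => (S : ℝ) * ∑ j ∈ Finset.range (P + 1), ∑ l,
      gaborSumFn N r M 0 (fun _ => coordSeq (W j) l) (coordSeq Z l) lam :=
    (summable_sum fun j hj => summable_sum (hsum j hj)).mul_left _
  have hle := gaborSumFn_le_sum_coordSeq hN M P hW hZ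
  have hs : Summable (gaborSumFn N r M P W Z) :=
    hmaj.of_nonneg_of_le (gaborSumFn_nonneg N r M P W Z) hle
  have hS2 : (S : ℝ) ≤ 2 ^ (S - 1) := by
    have := Nat.lt_two_pow_self (n := S - 1)
    exact_mod_cast (by omega : S ≤ 2 ^ (S - 1))
  refine ⟨hs, (hs.tsum_le_tsum hle hmaj).trans ?_⟩
  rw [tsum_mul_left, Summable.tsum_finsetSum fun j hj => summable_sum (hsum j hj)]
  calc (S : ℝ) * ∑ j ∈ Finset.range (P + 1), ∑' lam, ∑ l,
        gaborSumFn N r M 0 (fun _ => coordSeq (W j) l) (coordSeq Z l) lam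
      ≤ S * ∑ j ∈ Finset.range (P + 1), β₀ * l2normSq (Lambda N r) Z := by
        gcongr with j hj
        rw [Summable.tsum_finsetSum (hsum j hj), l2normSq_eq_sum_coordSeq hZ, Finset.mul_sum]
        exact Finset.sum_le_sum fun l _ =>
          (hcoord l j (Finset.mem_range_succ_iff.mp hj) _ (hZ.coordSeq l)).2
    _ = S * ((P + 1) * β₀ * l2normSq (Lambda N r) Z) := by
        simp [mul_assoc]
    _ ≤ 2 ^ (S - 1) * ((P + 1) * β₀ * l2normSq (Lambda N r) Z) := by
        have := l2normSq_nonneg (Lambda N r) Z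
        gcongr
    _ = 2 ^ (S - 1) * (P + 1) * β₀ * l2normSq (Lambda N r) Z := by ring
end
end
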